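/- arXiv:0708.3591 — 5 statements merged into one kernel-verified Lean document; each statement's English description precedes it below -/
import Mathlib

section
/- Let q, s ∈ ℍ with |q| < |s|. Then the series Σ_{n≥0} qⁿ s^{−1−n} converges absolutely in ℍ, and its sum A satisfies the identity A·s − q·A = 1. -/
local notation "ℍ" => Quaternion ℝ

/-- For quaternions `q, s` with `|q| < |s|`, the Cauchy kernel series
`Σ_{n≥0} qⁿ s^{−1−n}` converges absolutely, and its sum `A` satisfies `A·s − q·A = 1`. -/
theorem cauchy_kernel_series_summable_and_eq (q s : ℍ) (h : ‖q‖ < ‖s‖) :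
    Summable (fun n : ℕ => ‖q ^ n * s ^ (-1 - (n : ℤ))‖) ∧
    (∑' n : ℕ, q ^ n * s ^ (-1 - (n : ℤ))) * s -
      q * (∑' n : ℕ, q ^ n * s ^ (-1 - (n : ℤ))) = 1 := by
  have hs : s ≠ 0 := norm_pos_iff.mp ((norm_nonneg q).trans_lt h)
  have hsum : Summable (fun n : ℕ => ‖q ^ n * s ^ (-1 - (n : ℤ))‖) := by
    have hgeom : Summable (fun n : ℕ => (‖q‖ / ‖s‖) ^ n * ‖s‖⁻¹) :=
      (summable_geometric_of_lt_one (by positivity)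
        ((div_lt_one (norm_pos_iff.mpr hs)).mpr h)).mul_right _
    refine hgeom.congr fun n => ?_
    rw [norm_mul, norm_pow, norm_zpow, sub_eq_add_neg, add_comm,
      zpow_add₀ (norm_ne_zero_iff.mpr hs), zpow_neg, zpow_natCast, zpow_neg_one, div_pow,
      div_eq_mul_inv, mul_assoc]
  refine ⟨hsum, ?_⟩
  have hA : Summable (fun n : ℕ => q ^ n * s ^ (-1 - (n : ℤ))) := hsum.of_norm
  have hright : ∀ n : ℕ, q ^ n * s ^ (-1 - (n : ℤ)) * s = q ^ n * s ^ (-(n : ℤ)) := fun n => by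
    rw [mul_assoc, ← zpow_add_one₀ hs]
    congr 2
    ring
  have hleft : ∀ n : ℕ,
      q * (q ^ n * s ^ (-1 - (n : ℤ))) = q ^ (n + 1) * s ^ (-((n + 1 : ℕ) : ℤ)) := fun n => by
    rw [← mul_assoc, ← pow_succ']
    congr 2
    push_cast
    ring
  have hterms : Summable (fun n : ℕ => q ^ n * s ^ (-(n : ℤ))) :=
    (hA.mul_right s).congr hright
  rw [← hA.tsum_mul_right s, ← hA.tsum_mul_left q, tsum_congr hright, tsum_congr hleft,
    hterms.tsum_eq_zero_add]
  simp
end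

section
/- Let q, s ∈ ℍ with q·s ≠ s·q. Then q − s̄ = s + q − 2·Re s is nonzero, the two elements (s + q − 2·Re s)^{−1}·(s·q − |s|²) − q and −(q − s̄)^{−1}·(q² − 2·(Re s)·q + |s|²) of ℍ are equal, and this common element S satisfies the quadratic equation S² + S·q − s·S = 0. -/
local notation "ℍ" => Quaternion ℝ

/-- For quaternions `q, s` with `q·s ≠ s·q`:
`q − s̄ = s + q − 2·Re s` is nonzero, the two expressions for `S(s,q)` agree, and
`S = S(s,q)` satisfies `S² + S·q − s·S = 0`. -/
theorem S_kernel_inverse_solves_quadratic (q s : ℍ) (h : q * s ≠ s * q) :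
    q - star s ≠ 0 ∧
    q - star s = s + q - 2 * (s.re : ℍ) ∧
    (s + q - 2 * (s.re : ℍ))⁻¹ * (s * q - ((‖s‖ ^ 2 : ℝ) : ℍ)) - q =
      -((q - star s)⁻¹ * (q ^ 2 - 2 * (s.re : ℍ) * q + ((‖s‖ ^ 2 : ℝ) : ℍ))) ∧
    ((s + q - 2 * (s.re : ℍ))⁻¹ * (s * q - ((‖s‖ ^ 2 : ℝ) : ℍ)) - q) ^ 2 +
      ((s + q - 2 * (s.re : ℍ))⁻¹ * (s * q - ((‖s‖ ^ 2 : ℝ) : ℍ)) - q) * q -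
      s * ((s + q - 2 * (s.re : ℍ))⁻¹ * (s * q - ((‖s‖ ^ 2 : ℝ) : ℍ)) - q) = 0 := by
  have hd : q - star s ≠ 0 := fun h0 => h <| by
    rw [sub_eq_zero.mp h0, Quaternion.star_mul_self, Quaternion.self_mul_star]
  have hT : 2 * (s.re : ℍ) = s + star s := (Quaternion.self_add_star s).symm
  have hN : ((‖s‖ ^ 2 : ℝ) : ℍ) = s * star s := by
    rw [Quaternion.self_mul_star, Quaternion.normSq_eq_norm_mul_self, pow_two]
  have hcomm : ∀ x : ℍ, (s + star s) * x = x * (s + star s) := fun x => by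
    rw [Quaternion.self_add_star', Quaternion.coe_commutes]
  have hss : star s * s = s * star s := by
    rw [Quaternion.self_mul_star, Quaternion.star_mul_self]
  have hsq : s + q - (s + star s) = q - star s := by abel
  have hfactor : s * q - s * star s = s * (q - star s) := (mul_sub ..).symm
  rw [hT, hN, hsq]
  refine ⟨hd, rfl, ?_, ?_⟩
  · apply mul_left_cancel₀ hd
    rw [mul_sub, mul_neg, mul_inv_cancel_left₀ hd, mul_inv_cancel_left₀ hd]
    noncomm_ring
  · rw [hfactor]
    set d := q - star s with hd_def
    set u := d⁻¹ * (s * d)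
    have hdu : d * u = s * d := mul_inv_cancel_left₀ hd _
    have huu : u * u = (s + star s) * u - s * star s := by
      apply mul_left_cancel₀ hd
      calc d * (u * u) = s * (d * u) := by rw [← mul_assoc, hdu, mul_assoc, hdu]
        _ = s * s * d := by rw [hdu, ← mul_assoc]
        _ = (s + star s) * (s * d) - star s * s * d := by noncomm_ring
        _ = d * ((s + star s) * u - s * star s) := by
          rw [mul_sub d, ← mul_assoc d, ← hcomm d, mul_assoc _ d, hdu, hss,
            Quaternion.self_mul_star, Quaternion.coe_commutes]
    calc (u - q) ^ 2 + (u - q) * q - s * (u - q)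
        = u * u - (s + q) * u + s * q := by noncomm_ring
      _ = u * u - (d + (s + star s)) * u + s * q := by rw [hd_def]; congr 3; abel
      _ = 0 := by rw [add_mul d, hdu, huu, hd_def]; noncomm_ring
end

section
/- Let q, s ∈ ℍ with |q| < |s|. Then the quaternion q² − 2·(Re s)·q + |s|² is nonzero (hence invertible), and the Cauchy kernel series satisfies Σ_{n≥0} qⁿ s^{−1−n} = −(q² − 2·(Re s)·q + |s|²)^{−1}·(q − s̄). -/
local notation "ℍ" => Quaternion ℝ

/-- In a normed division ring, the series `Σ qⁿ s^{−1−n}` is summable when `‖q‖ < ‖s‖`. -/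
theorem summable_pow_mul_zpow_neg_one_sub {D : Type*} [NormedDivisionRing D] [CompleteSpace D]
    {q s : D} (h : ‖q‖ < ‖s‖) : Summable (fun n : ℕ => q ^ n * s ^ (-1 - (n : ℤ))) := by
  have hs : 0 < ‖s‖ := (norm_nonneg q).trans_lt h
  have hs0 : s ≠ 0 := norm_pos_iff.mp hs
  refine Summable.of_norm_bounded (g := fun n : ℕ => ‖s‖⁻¹ * (‖q‖ / ‖s‖) ^ n)
    ((summable_geometric_of_lt_one (by positivity) ((div_lt_one hs).2 h)).mul_left _) fun n => ?_
  rw [norm_mul, norm_pow, norm_zpow, zpow_sub₀ hs.ne', zpow_neg_one, zpow_natCast, div_pow]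
  apply le_of_eq
  ring

/-- The sum `S` of the series `Σ qⁿ s^{−1−n}` solves the Sylvester equation `q S = S s − 1`. -/
theorem mul_tsum_pow_mul_zpow_neg_one_sub {D : Type*} [NormedDivisionRing D] [CompleteSpace D]
    {q s : D} (h : ‖q‖ < ‖s‖) :
    q * ∑' n : ℕ, q ^ n * s ^ (-1 - (n : ℤ)) =
      (∑' n : ℕ, q ^ n * s ^ (-1 - (n : ℤ))) * s - 1 := by
  have hs : s ≠ 0 := norm_pos_iff.mp ((norm_nonneg q).trans_lt h)
  have hsum := summable_pow_mul_zpow_neg_one_sub h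
  have hshift (n : ℕ) : q * (q ^ n * s ^ (-1 - (n : ℤ))) =
      q ^ (n + 1) * s ^ (-1 - ((n + 1 : ℕ) : ℤ)) * s := by
    rw [mul_assoc _ _ s, ← zpow_add_one₀ hs, pow_succ', mul_assoc]
    congr 3
    push_cast
    ring
  rw [← hsum.tsum_mul_left, ← hsum.tsum_mul_right, (hsum.mul_right s).tsum_eq_zero_add]
  simp [hshift, hs]

/-- If `q S = S s − 1`, then `(q² − 2 (Re s) q + |s|²) S = s̄ − q`. -/
theorem Quaternion.sq_sub_two_re_mul_add_norm_sq_mul {q s S : ℍ} (hS : q * S = S * s - 1) :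
    (q ^ 2 - 2 * (s.re : ℍ) * q + ((‖s‖ ^ 2 : ℝ) : ℍ)) * S = star s - q := by
  have hstar : 2 * (s.re : ℍ) = s + star s := by
    rw [Quaternion.self_add_star]
  have hnorm : ((‖s‖ ^ 2 : ℝ) : ℍ) = s * star s := by
    rw [Quaternion.self_mul_star, Quaternion.normSq_eq_norm_mul_self, sq]
  have hre : 2 * (s.re : ℍ) * (S * s) = S * s * (2 * (s.re : ℍ)) := by
    rw [mul_assoc, Quaternion.coe_commutes s.re (S * s), ← mul_assoc, (Commute.ofNat_left 2 (S * s)).eq,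
      mul_assoc]
  calc
    _ = q * (q * S) - 2 * (s.re : ℍ) * (q * S) + ((‖s‖ ^ 2 : ℝ) : ℍ) * S := by noncomm_ring
    _ = (q * S) * s - q - (S * s * (2 * (s.re : ℍ)) - 2 * (s.re : ℍ)) +
        S * ((‖s‖ ^ 2 : ℝ) : ℍ) := by
      rw [Quaternion.coe_commutes (‖s‖ ^ 2) S, hS, mul_sub (2 * (s.re : ℍ)), hre, mul_sub q,
        ← mul_assoc q S s, hS, mul_one, mul_one]
    _ = star s - q := by
      rw [hS, hstar, hnorm]
      have hc : star s * s = s * star s := by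
        rw [Quaternion.self_mul_star, Quaternion.star_mul_self]
      noncomm_ring

/-- For quaternions `q, s` with `|q| < |s|`, the quaternion
`q² − 2·(Re s)·q + |s|²` is nonzero, and the Cauchy kernel series satisfies
`Σ_{n≥0} qⁿ s^{−1−n} = −(q² − 2·(Re s)·q + |s|²)^{−1}·(q − s̄)`. -/
theorem cauchy_kernel_series_closed_form (q s : ℍ) (h : ‖q‖ < ‖s‖) :
    q ^ 2 - 2 * (s.re : ℍ) * q + ((‖s‖ ^ 2 : ℝ) : ℍ) ≠ 0 ∧
    Summable (fun n : ℕ => q ^ n * s ^ (-1 - (n : ℤ))) ∧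
    ∑' n : ℕ, q ^ n * s ^ (-1 - (n : ℤ)) =
      -((q ^ 2 - 2 * (s.re : ℍ) * q + ((‖s‖ ^ 2 : ℝ) : ℍ))⁻¹ * (q - star s)) := by
  have key := Quaternion.sq_sub_two_re_mul_add_norm_sq_mul (mul_tsum_pow_mul_zpow_neg_one_sub h)
  have hne : q ^ 2 - 2 * (s.re : ℍ) * q + ((‖s‖ ^ 2 : ℝ) : ℍ) ≠ 0 := by
    intro h0
    rw [h0, zero_mul, eq_comm, sub_eq_zero] at key
    rw [← key, norm_star] at h
    exact h.false
  refine ⟨hne, summable_pow_mul_zpow_neg_one_sub h, ?_⟩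
  rw [← mul_neg, neg_sub, ← key, inv_mul_cancel_left₀ hne]
end

section
/- Let s ∈ ℍ. Then for every q ∈ ℍ, one has q² − 2·(Re s)·q + |s|² = 0 if and only if Re q = Re s and |q| = |s|; that is, the zero set of q ↦ q² − 2·(Re s)·q + |s|² is the sphere of quaternions with the same real part and the same norm as s. -/
local notation "ℍ" => Quaternion ℝ

/-- For `s ∈ ℍ`, the zero set of `q ↦ q² − 2·(Re s)·q + |s|²` is exactly
the sphere of quaternions with the same real part and the same norm as `s`. -/
theorem zero_set_characteristic_polynomial (s : ℍ) :
    ∀ q : ℍ, q ^ 2 - 2 * (s.re : ℍ) * q + ((‖s‖ ^ 2 : ℝ) : ℍ) = 0 ↔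
      q.re = s.re ∧ ‖q‖ = ‖s‖ := by
  intro q
  have norm_sq (p : ℍ) : ‖p‖ ^ 2 = p.re ^ 2 + p.imI ^ 2 + p.imJ ^ 2 + p.imK ^ 2 := by
    rw [sq, ← Quaternion.normSq_eq_norm_mul_self, Quaternion.normSq_def']
  have two_mul_re : 2 * (s.re : ℍ) = ((2 * s.re : ℝ) : ℍ) := by
    rw [two_mul, two_mul, Quaternion.coe_add]
  rw [← sq_eq_sq₀ (norm_nonneg q) (norm_nonneg s), two_mul_re, sq q, norm_sq, norm_sq,
    Quaternion.ext_iff]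
  simp only [Quaternion.re_add, Quaternion.imI_add, Quaternion.imJ_add, Quaternion.imK_add,
    Quaternion.re_sub, Quaternion.imI_sub, Quaternion.imJ_sub, Quaternion.imK_sub,
    Quaternion.re_mul, Quaternion.imI_mul, Quaternion.imJ_mul, Quaternion.imK_mul,
    Quaternion.re_coe, Quaternion.imI_coe, Quaternion.imJ_coe, Quaternion.imK_coe,
    Quaternion.re_zero, Quaternion.imI_zero, Quaternion.imJ_zero, Quaternion.imK_zero]
  constructor
  · rintro ⟨hr, hi, hj, hk⟩
    have hre : q.re = s.re := by
      by_contra hne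
      have hsub : q.re - s.re ≠ 0 := sub_ne_zero.mpr hne
      have hi0 : q.imI = 0 := mul_left_cancel₀ hsub (by linarith)
      have hj0 : q.imJ = 0 := mul_left_cancel₀ hsub (by linarith)
      have hk0 : q.imK = 0 := mul_left_cancel₀ hsub (by linarith)
      rw [hi0, hj0, hk0] at hr
      nlinarith [sq_pos_of_ne_zero hsub, sq_nonneg s.imI, sq_nonneg s.imJ, sq_nonneg s.imK]
    refine ⟨hre, ?_⟩
    rw [hre] at hr ⊢
    linarith
  · rintro ⟨hre, hnorm⟩
    rw [hre] at hnorm ⊢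
    refine ⟨?_, ?_, ?_, ?_⟩ <;> linarith
end

section
/- Let s ∈ ℍ be a non-real quaternion (Im s ≠ 0), let D = {q ∈ ℍ : q² − 2·(Re s)·q + |s|² ≠ 0}, and define F : D → ℍ by F(q) = −(q² − 2·(Re s)·q + |s|²)^{−1}·(q − s̄). Then there exists no L ∈ ℍ such that F(q) tends to L as q tends to s̄ within D; i.e., the Cauchy kernel S^{−1}(s,·) cannot be extended continuously to the point q = s̄. -/
local notation "ℍ" => Quaternion ℝ

/-- A nonzero imaginary quaternion orthogonal to the imaginary part of `s`. -/
lemma exists_imaginary_ne_zero_orthogonal (s : ℍ) :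
    ∃ w : ℍ, w ≠ 0 ∧ w.re = 0 ∧ s.imI * w.imI + s.imJ * w.imJ + s.imK * w.imK = 0 := by
  by_cases h : s.imI = 0 ∧ s.imJ = 0
  · refine ⟨⟨0, 1, 0, 0⟩, fun h0 => ?_, rfl, by simp [h.1]⟩
    simpa using (congrArg (fun q : ℍ => q.imI) h0).trans Quaternion.imI_zero
  · refine ⟨⟨0, s.imJ, -s.imI, 0⟩, fun h0 => h ⟨?_, ?_⟩, rfl, by simp; ring⟩
    · simpa using (congrArg (fun q : ℍ => q.imJ) h0).trans Quaternion.imJ_zero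
    · simpa using (congrArg (fun q : ℍ => q.imI) h0).trans Quaternion.imI_zero

/-- At `q = s̄ + h`, with `h` imaginary and orthogonal to `Im s`, the polynomial
`q² − 2·(Re s)·q + |s|²` takes the value `h²`. -/
lemma sphere_polynomial_star_add (s h : ℍ) (hre : h.re = 0)
    (horth : s.imI * h.imI + s.imJ * h.imJ + s.imK * h.imK = 0) :
    (star s + h) ^ 2 - 2 * (s.re : ℍ) * (star s + h) + ((‖s‖ ^ 2 : ℝ) : ℍ) = h ^ 2 := by
  have hn : ‖s‖ ^ 2 = s.re ^ 2 + s.imI ^ 2 + s.imJ ^ 2 + s.imK ^ 2 := by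
    rw [← Quaternion.normSq_def', Quaternion.normSq_eq_norm_mul_self, sq]
  have h2 : (2 : ℍ) * (s.re : ℍ) = ((2 * s.re : ℝ) : ℍ) := by push_cast; rfl
  rw [hn, h2, sq (star s + h), sq h]
  ext <;>
    simp only [Quaternion.re_add, Quaternion.imI_add, Quaternion.imJ_add, Quaternion.imK_add,
      Quaternion.re_sub, Quaternion.imI_sub, Quaternion.imJ_sub, Quaternion.imK_sub,
      Quaternion.re_mul, Quaternion.imI_mul, Quaternion.imJ_mul, Quaternion.imK_mul,
      Quaternion.re_star, Quaternion.imI_star, Quaternion.imJ_star, Quaternion.imK_star,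
      Quaternion.re_coe, Quaternion.imI_coe, Quaternion.imJ_coe, Quaternion.imK_coe, hre]
  · linear_combination 2 * horth
  all_goals ring

/-- For a non-real quaternion `s`, the Cauchy kernel
`F(q) = −(q² − 2·(Re s)·q + |s|²)^{−1}·(q − s̄)`, defined on
`D = {q : q² − 2·(Re s)·q + |s|² ≠ 0}`, has no limit as `q → s̄` within `D`. -/
theorem cauchy_kernel_no_continuous_extension (s : ℍ) (hs : s.im ≠ 0) :
    ¬ ∃ L : ℍ, Filter.Tendsto
      (fun q : ℍ => -((q ^ 2 - 2 * (s.re : ℍ) * q + ((‖s‖ ^ 2 : ℝ) : ℍ))⁻¹ * (q - star s)))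
      (nhdsWithin (star s)
        {q : ℍ | q ^ 2 - 2 * (s.re : ℍ) * q + ((‖s‖ ^ 2 : ℝ) : ℍ) ≠ 0})
      (nhds L) := by
  rintro ⟨L, hL⟩
  obtain ⟨w, hw, hre, horth⟩ := exists_imaginary_ne_zero_orthogonal s
  have hQ (t : ℝ) := sphere_polynomial_star_add s (t • w) (by simp [hre])
    (by simp only [Quaternion.imI_smul, Quaternion.imJ_smul, Quaternion.imK_smul, smul_eq_mul]
        linear_combination t * horth)
  have hh : Filter.Tendsto (fun t : ℝ => t • w) (nhdsWithin 0 {0}ᶜ) (nhds 0) := by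
    have hc : Continuous fun t : ℝ => t • w := by fun_prop
    simpa using (hc.tendsto 0).mono_left nhdsWithin_le_nhds
  have hne : ∀ᶠ t : ℝ in nhdsWithin 0 {0}ᶜ, t • w ≠ 0 := by
    filter_upwards [self_mem_nhdsWithin] with t ht
    exact smul_ne_zero ht hw
  have hpath : Filter.Tendsto (fun t : ℝ => star s + t • w) (nhdsWithin 0 {0}ᶜ)
      (nhdsWithin (star s)
        {q : ℍ | q ^ 2 - 2 * (s.re : ℍ) * q + ((‖s‖ ^ 2 : ℝ) : ℍ) ≠ 0}) := by
    refine tendsto_nhdsWithin_iff.mpr ⟨by simpa using hh.const_add (star s), ?_⟩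
    filter_upwards [hne] with t ht
    exact (hQ t).trans_ne (pow_ne_zero 2 ht)
  have hprod := hh.mul (hL.comp hpath)
  rw [zero_mul] at hprod
  have hconst : Filter.Tendsto (fun _ : ℝ => (-1 : ℍ)) (nhdsWithin 0 {0}ᶜ) (nhds 0) := by
    refine hprod.congr' ?_
    filter_upwards [hne] with t ht
    rw [Function.comp_apply, hQ t, add_sub_cancel_left, sq, mul_inv_rev, mul_neg, mul_assoc,
      inv_mul_cancel₀ ht, mul_one, mul_inv_cancel₀ ht]
  exact neg_ne_zero.mpr one_ne_zero (tendsto_nhds_unique tendsto_const_nhds hconst)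
end
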